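/- For every MBS (Σ, ar): the Arnold–Nivat distance d is well defined and is a metric on T_Σ^∞ satisfying the strong triangle inequality d(t,v) ≤ max (d(t,u), d(u,v)); in particular two raw mixed terms whose mixed truncations agree at every depth are equal; and the metric space (T_Σ^∞, d) is complete. -/

import Mathlib

set_option linter.unusedVariables false
set_option linter.unnecessarySeqFocus false

namespace Fanfic

/-- A mixed binding signature. -/
structure MBS (𝕍 : Type) : Type 1 where
  Cons : Type
  countable : Countable Cons
  ar : Cons → List (ℕ × Bool)

variable {𝕍 : Type}

/-- Raw finite terms on a mixed binding signature. -/
inductive PreTm (𝕍 : Type) (S : MBS 𝕍) : Type where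
  | var : 𝕍 → PreTm 𝕍 S
  | op (o : S.Cons)
      (binds : (i : Fin (S.ar o).length) → Fin ((S.ar o).get i).1 → 𝕍)
      (args : Fin (S.ar o).length → PreTm 𝕍 S) : PreTm 𝕍 S

/-- Raw finite terms over the signature extended with a fresh constant `∗`. -/
inductive TmStar (𝕍 : Type) (S : MBS 𝕍) : Type where
  | star : TmStar 𝕍 S
  | var : 𝕍 → TmStar 𝕍 S
  | op (o : S.Cons)
      (binds : (i : Fin (S.ar o).length) → Fin ((S.ar o).get i).1 → 𝕍)
      (args : Fin (S.ar o).length → TmStar 𝕍 S) : TmStar 𝕍 S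

def PreTm.toStar {S : MBS 𝕍} : PreTm 𝕍 S → TmStar 𝕍 S
  | .var x => .var x
  | .op o binds args => .op o binds (fun i => (args i).toStar)

/-- Mixed truncation at a given depth (of a term possibly containing `∗`). -/
def TmStar.trunc {S : MBS 𝕍} : TmStar 𝕍 S → ℕ → TmStar 𝕍 S
  | _, 0 => .star
  | .star, _ + 1 => .star
  | .var x, _ + 1 => .var x
  | .op o binds args, n + 1 =>
      .op o binds (fun i => (args i).trunc (if ((S.ar o).get i).2 then n else n + 1))

/-- Mixed truncation of a raw finite term at a given depth. -/
def PreTm.trunc {S : MBS 𝕍} (t : PreTm 𝕍 S) (n : ℕ) : TmStar 𝕍 S :=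
  t.toStar.trunc n

/-- The inner inductive layer `μX.F_Σ(X,Y)` of the mixed terms on a signature. -/
inductive Inner (𝕍 : Type) (S : MBS 𝕍) (Y : Type) : Type where
  | var : 𝕍 → Inner 𝕍 S Y
  | op (o : S.Cons)
      (binds : (i : Fin (S.ar o).length) → Fin ((S.ar o).get i).1 → 𝕍)
      (argsI : (i : Fin (S.ar o).length) → ((S.ar o).get i).2 = false → Inner 𝕍 S Y)
      (argsC : (i : Fin (S.ar o).length) → ((S.ar o).get i).2 = true → Y) : Inner 𝕍 S Y

/-- Coinductive positions (holes) of an inner layer. -/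
inductive Hole {𝕍 : Type} {S : MBS 𝕍} : Inner 𝕍 S PUnit → Type where
  | top {o : S.Cons} {binds} {argsI} {argsC} (i : Fin (S.ar o).length)
      (h : ((S.ar o).get i).2 = true) : Hole (Inner.op o binds argsI argsC)
  | sub {o : S.Cons} {binds} {argsI} {argsC} (i : Fin (S.ar o).length)
      (h : ((S.ar o).get i).2 = false) :
      Hole (argsI i h) → Hole (Inner.op o binds argsI argsC)

/-- The polynomial functor `Y ↦ μX.F_Σ(X,Y)`. -/
def MixPF (𝕍 : Type) (S : MBS 𝕍) : PFunctor.{0} :=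
  ⟨Inner 𝕍 S PUnit, Hole⟩

/-- Raw mixed terms: the M-type (terminal coalgebra) of `Y ↦ μX.F_Σ(X,Y)`. -/
def TmInf (𝕍 : Type) (S : MBS 𝕍) : Type :=
  PFunctor.M (MixPF 𝕍 S)

/-- Split an element of `μX.F_Σ(X,Y)` into a shape and the values of its holes. -/
noncomputable def Inner.split {S : MBS 𝕍} {Y : Type} (t : Inner 𝕍 S Y) :
    Σ a : Inner 𝕍 S PUnit, (Hole a → Y) :=
  Inner.rec (motive := fun _ => Σ a : Inner 𝕍 S PUnit, (Hole a → Y))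
    (fun x => ⟨.var x, fun h => nomatch h⟩)
    (fun o binds _argsI argsC ihI =>
      ⟨.op o binds (fun i h => (ihI i h).1) (fun _ _ => PUnit.unit),
        fun h =>
          match h with
          | .top i hb => argsC i hb
          | .sub i hb p => (ihI i hb).2 p⟩)
    t

/-- Build a mixed term from one inner layer whose holes carry mixed terms. -/
noncomputable def mixMk {S : MBS 𝕍} (t : Inner 𝕍 S (TmInf 𝕍 S)) : TmInf 𝕍 S :=
  PFunctor.M.mk t.split

/-- Re-assemble an inner layer from a shape and hole values. -/
def Inner.graft {S : MBS 𝕍} {Y : Type} :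
    (a : Inner 𝕍 S PUnit) → (Hole a → Y) → Inner 𝕍 S Y
  | .var x, _ => .var x
  | .op o binds argsI _, g =>
      .op o binds (fun i h => (argsI i h).graft (fun p => g (.sub i h p)))
        (fun i h => g (.top i h))

/-- Expose the top inner layer of a mixed term. -/
def TmInf.expose {S : MBS 𝕍} (t : TmInf 𝕍 S) : Inner 𝕍 S (TmInf 𝕍 S) :=
  (PFunctor.M.dest t).1.graft (PFunctor.M.dest t).2

/-- Truncation of a shape, given truncations for its holes. -/
def truncShape {S : MBS 𝕍} :
    (a : Inner 𝕍 S PUnit) → (Hole a → TmStar 𝕍 S) → TmStar 𝕍 S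
  | .var x, _ => .var x
  | .op o binds argsI _, g =>
      .op o binds (fun i =>
        if h : ((S.ar o).get i).2 = true then g (.top i h)
        else truncShape (argsI i (Bool.eq_false_iff.mpr h)) (fun p => g (.sub i _ p)))

/-- Mixed truncation of a raw mixed term at a given depth. -/
def TmInf.trunc {S : MBS 𝕍} : ℕ → TmInf 𝕍 S → TmStar 𝕍 S
  | 0, _ => .star
  | n + 1, t =>
      truncShape (PFunctor.M.dest t).1 (fun h => TmInf.trunc n ((PFunctor.M.dest t).2 h))

/-- The Arnold–Nivat metric on raw mixed terms. -/
noncomputable def dInf {S : MBS 𝕍} (t u : TmInf 𝕍 S) : ℝ :=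
  sInf {r : ℝ | ∃ n : ℕ, TmInf.trunc n t = TmInf.trunc n u ∧ r = (2 : ℝ)⁻¹ ^ n}

/-- The Arnold–Nivat metric on raw finite terms. -/
noncomputable def dFin {S : MBS 𝕍} (t u : PreTm 𝕍 S) : ℝ :=
  sInf {r : ℝ | ∃ n : ℕ, t.trunc n = u.trunc n ∧ r = (2 : ℝ)⁻¹ ^ n}

/-- The canonical inclusion of finite terms into mixed terms, inner part. -/
noncomputable def PreTm.embedInner {S : MBS 𝕍} : PreTm 𝕍 S → Inner 𝕍 S (TmInf 𝕍 S)
  | .var x => .var x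
  | .op o binds args =>
      .op o binds (fun i _ => (args i).embedInner) (fun i _ => mixMk ((args i).embedInner))

/-- The canonical inclusion of raw finite terms into raw mixed terms. -/
noncomputable def PreTm.embed {S : MBS 𝕍} (t : PreTm 𝕍 S) : TmInf 𝕍 S :=
  mixMk t.embedInner

/-- Cauchy sequences for an explicitly given distance function. -/
def SeqCauchy {X : Type*} (d : X → X → ℝ) (s : ℕ → X) : Prop :=
  ∀ ε : ℝ, 0 < ε → ∃ N : ℕ, ∀ m ≥ N, ∀ n ≥ N, d (s m) (s n) < ε

/-- Convergence of a sequence for an explicitly given distance function. -/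
def SeqTendsto {X : Type*} (d : X → X → ℝ) (s : ℕ → X) (l : X) : Prop :=
  ∀ ε : ℝ, 0 < ε → ∃ N : ℕ, ∀ n ≥ N, d (s n) l < ε

end Fanfic

namespace Fanfic

section

variable {S : MBS 𝕍}

/-- A truncated layer determines its shape and the truncations put in its holes. -/
theorem truncShape_injective {a b : Inner 𝕍 S PUnit} {f : Hole a → TmStar 𝕍 S}
    {g : Hole b → TmStar 𝕍 S} (h : truncShape a f = truncShape b g) :
    (⟨a, f⟩ : Σ a : Inner 𝕍 S PUnit, (Hole a → TmStar 𝕍 S)) = ⟨b, g⟩ := by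
  induction a generalizing b with
  | var x =>
    cases b with
    | var y =>
      simp only [truncShape, TmStar.var.injEq] at h
      subst h
      congr 1
      funext p
      cases p
    | op => simp [truncShape] at h
  | op o binds argsI argsC ih =>
    cases b with
    | var y => simp [truncShape] at h
    | op o' binds' argsI' argsC' =>
      simp only [truncShape, TmStar.op.injEq] at h
      obtain ⟨rfl, hbinds, hargs⟩ := h
      obtain rfl := eq_of_heq hbinds
      have hargs := congrFun (eq_of_heq hargs)
      have hsub (i) (hi : ((S.ar o).get i).2 = false) :
          (⟨argsI i hi, fun p => f (.sub i hi p)⟩ :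
            Σ a : Inner 𝕍 S PUnit, (Hole a → TmStar 𝕍 S)) =
          ⟨argsI' i hi, fun p => g (.sub i hi p)⟩ := by
        apply ih
        have := hargs i
        rwa [dif_neg (Bool.eq_false_iff.mp hi), dif_neg (Bool.eq_false_iff.mp hi)] at this
      obtain rfl : argsI = argsI' := by
        funext i hi
        exact congrArg Sigma.fst (hsub i hi)
      obtain rfl : argsC = argsC' := by
        funext i hi
        rfl
      congr 1
      funext p
      cases p with
      | top i hi =>
        have := hargs i
        rwa [dif_pos hi, dif_pos hi] at this
      | sub i hi p => exact congrFun (eq_of_heq (Sigma.mk.inj (hsub i hi)).2) p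

/-- Mixed truncations of terms carry the same information as the finite approximations in the
M-type. -/
theorem TmInf.trunc_eq_iff {n : ℕ} {t u : TmInf 𝕍 S} :
    TmInf.trunc n t = TmInf.trunc n u ↔
      PFunctor.MIntl.approx t n = PFunctor.MIntl.approx u n := by
  induction n generalizing t u with
  | zero => simpa [TmInf.trunc] using Subsingleton.elim _ _
  | succ n ih =>
    rw [← PFunctor.M.mk_dest t, ← PFunctor.M.mk_dest u]
    rcases PFunctor.M.dest t with ⟨a, f⟩
    rcases PFunctor.M.dest u with ⟨b, g⟩
    simp only [TmInf.trunc, PFunctor.M.approx_mk]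
    constructor
    · intro h
      have h := truncShape_injective h
      obtain ⟨rfl, h⟩ := Sigma.mk.inj h
      congr 1
      funext p
      exact ih.mp (congrFun (eq_of_heq h) p)
    · intro h
      obtain ⟨rfl, h⟩ := PFunctor.Approx.CofixA.intro.inj h
      congr 1
      funext p
      exact ih.mpr (congrFun (eq_of_heq h) p)

theorem TmInf.eq_of_forall_trunc_eq {t u : TmInf 𝕍 S}
    (h : ∀ n, TmInf.trunc n t = TmInf.trunc n u) : t = u :=
  PFunctor.M.ext' _ _ _ fun n => TmInf.trunc_eq_iff.mp (h n)

theorem TmInf.trunc_eq_of_le {m n : ℕ} (hmn : m ≤ n) {t u : TmInf 𝕍 S}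
    (h : TmInf.trunc n t = TmInf.trunc n u) : TmInf.trunc m t = TmInf.trunc m u := by
  induction n, hmn using Nat.le_induction with
  | base => exact h
  | succ n _ ih =>
    refine ih (TmInf.trunc_eq_iff.mpr ?_)
    rw [← PFunctor.M.truncate_approx t, ← PFunctor.M.truncate_approx u, TmInf.trunc_eq_iff.mp h]

theorem dInf_le_of_trunc_eq {n : ℕ} {t u : TmInf 𝕍 S}
    (h : TmInf.trunc n t = TmInf.trunc n u) : dInf t u ≤ (2 : ℝ)⁻¹ ^ n := by
  refine csInf_le ⟨0, ?_⟩ ⟨n, h, rfl⟩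
  rintro _ ⟨k, -, rfl⟩
  positivity

theorem exists_trunc_eq_of_dInf_lt {t u : TmInf 𝕍 S} {r : ℝ} (h : dInf t u < r) :
    ∃ n, TmInf.trunc n t = TmInf.trunc n u ∧ (2 : ℝ)⁻¹ ^ n < r := by
  obtain ⟨_, ⟨n, hn, rfl⟩, hr⟩ := exists_lt_of_csInf_lt (by exact ⟨_, 0, rfl, rfl⟩) h
  exact ⟨n, hn, hr⟩

theorem trunc_eq_of_dInf_lt {n : ℕ} {t u : TmInf 𝕍 S} (h : dInf t u < (2 : ℝ)⁻¹ ^ n) :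
    TmInf.trunc n t = TmInf.trunc n u := by
  obtain ⟨k, hk, hkn⟩ := exists_trunc_eq_of_dInf_lt h
  exact TmInf.trunc_eq_of_le
    ((pow_lt_pow_iff_right_of_lt_one₀ (by norm_num) (by norm_num)).mp hkn).le hk

theorem dInf_nonneg (t u : TmInf 𝕍 S) : 0 ≤ dInf t u := by
  apply Real.sInf_nonneg
  rintro _ ⟨n, -, rfl⟩
  positivity

theorem dInf_comm (t u : TmInf 𝕍 S) : dInf t u = dInf u t := by
  simp only [dInf, eq_comm (a := TmInf.trunc _ t)]

theorem dInf_eq_zero_iff {t u : TmInf 𝕍 S} : dInf t u = 0 ↔ t = u := by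
  constructor
  · intro h
    refine TmInf.eq_of_forall_trunc_eq fun n => trunc_eq_of_dInf_lt ?_
    rw [h]
    positivity
  · rintro rfl
    refine le_antisymm (le_of_forall_pos_le_add fun ε hε => ?_) (dInf_nonneg t t)
    obtain ⟨n, hn⟩ := exists_pow_lt_of_lt_one hε (by norm_num : (2 : ℝ)⁻¹ < 1)
    linarith [dInf_le_of_trunc_eq (rfl : TmInf.trunc n t = TmInf.trunc n t)]

theorem dInf_le_max (t u v : TmInf 𝕍 S) : dInf t v ≤ max (dInf t u) (dInf u v) := by
  by_contra! h
  obtain ⟨m, hm, hmlt⟩ := exists_trunc_eq_of_dInf_lt (max_lt_iff.mp h).1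
  obtain ⟨n, hn, hnlt⟩ := exists_trunc_eq_of_dInf_lt (max_lt_iff.mp h).2
  have htv := dInf_le_of_trunc_eq <| (TmInf.trunc_eq_of_le (min_le_left m n) hm).trans
    (TmInf.trunc_eq_of_le (min_le_right m n) hn)
  rcases min_choice m n with hk | hk <;> rw [hk] at htv <;> linarith

theorem exists_seqTendsto_of_seqCauchy {s : ℕ → TmInf 𝕍 S} (hs : SeqCauchy dInf s) :
    ∃ t, SeqTendsto dInf s t := by
  have hstab (n : ℕ) : ∃ N, ∀ m ≥ N, ∀ k ≥ N, TmInf.trunc n (s m) = TmInf.trunc n (s k) := by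
    obtain ⟨N, hN⟩ := hs ((2 : ℝ)⁻¹ ^ n) (by positivity)
    exact ⟨N, fun m hm k hk => trunc_eq_of_dInf_lt (hN m hm k hk)⟩
  choose N hN using hstab
  have happrox {n k : ℕ} (hk : N n ≤ k) :
      PFunctor.MIntl.approx (s k) n = PFunctor.MIntl.approx (s (N n)) n :=
    TmInf.trunc_eq_iff.mp (hN n k hk (N n) le_rfl)
  let t : TmInf 𝕍 S :=
    { approx := fun n => PFunctor.MIntl.approx (s (N n)) n
      consistent := fun n => by
        beta_reduce
        rw [← happrox (le_max_left (N n) (N (n + 1))),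
          ← happrox (le_max_right (N n) (N (n + 1)))]
        exact PFunctor.MIntl.consistent _ n }
  refine ⟨t, fun ε hε => ?_⟩
  obtain ⟨n, hn⟩ := exists_pow_lt_of_lt_one hε (by norm_num : (2 : ℝ)⁻¹ < 1)
  exact ⟨N n, fun k hk =>
    (dInf_le_of_trunc_eq (TmInf.trunc_eq_iff (u := t) |>.mpr (happrox hk))).trans_lt hn⟩

end

/-- For every MBS, the Arnold–Nivat distance is a metric on
`T_Σ^∞` satisfying the strong triangle inequality; in particular two raw mixed
terms whose mixed truncations agree at every depth are equal; and the metric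
space `(T_Σ^∞, d)` is complete. -/
theorem arnoldNivat_isMetric_ultrametric_complete
    {𝕍 : Type} [Infinite 𝕍] (S : MBS 𝕍) :
    (∀ t u : TmInf 𝕍 S, 0 ≤ dInf t u) ∧
    (∀ t u : TmInf 𝕍 S, dInf t u = dInf u t) ∧
    (∀ t u : TmInf 𝕍 S, dInf t u = 0 ↔ t = u) ∧
    (∀ t u v : TmInf 𝕍 S, dInf t v ≤ max (dInf t u) (dInf u v)) ∧
    (∀ t u : TmInf 𝕍 S, (∀ n : ℕ, TmInf.trunc n t = TmInf.trunc n u) → t = u) ∧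
    (∀ s : ℕ → TmInf 𝕍 S, SeqCauchy dInf s → ∃ t : TmInf 𝕍 S, SeqTendsto dInf s t) := by
  exact ⟨dInf_nonneg, dInf_comm, fun _ _ => dInf_eq_zero_iff, dInf_le_max,
    fun _ _ => TmInf.eq_of_forall_trunc_eq, fun _ => exists_seqTendsto_of_seqCauchy⟩

end Fanfic
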